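/- arXiv:1810.08278 — 2 statements merged into one kernel-verified Lean document; each statement's English description precedes it below -/
import Mathlib

section
/- Let β be a Borel probability measure on X and assume the Gibbs kernel k_ε is positive definite (‖ξ‖²_{k_ε} ≥ 0 for every finite signed Borel measure ξ). Then the Sinkhorn divergence is convex in its first variable: for all Borel probability measures α₀, α₁ on X and all t ∈ [0, 1], S_ε((1−t)α₀ + tα₁, β) ≤ (1−t) S_ε(α₀, β) + t S_ε(α₁, β). -/
open MeasureTheory Real Filter Topology
open scoped NNReal ENNReal

/-- The entropic dual functional `D_ε(α, β; f, g)`. -/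
noncomputable def Dfun {X : Type*} [MeasurableSpace X] (eps : ℝ) (C : X → X → ℝ)
    (alpha beta : Measure X) (f g : X → ℝ) : ℝ :=
  (∫ x, f x ∂alpha) + (∫ y, g y ∂beta) -
    eps * ∫ x, ∫ y, (Real.exp ((f x + g y - C x y) / eps) - 1) ∂beta ∂alpha

/-- The entropic transport cost `OT_ε(α, β)`, as a supremum of the dual
functional over pairs of continuous potentials. -/
noncomputable def OTcost {X : Type*} [TopologicalSpace X] [MeasurableSpace X] (eps : ℝ) (C : X → X → ℝ)
    (alpha beta : Measure X) : ℝ :=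
  sSup {r : ℝ | ∃ f g : X → ℝ, Continuous f ∧ Continuous g ∧ r = Dfun eps C alpha beta f g}

/-- The Sinkhorn divergence `S_ε(α, β)`. -/
noncomputable def Sinkhorn {X : Type*} [TopologicalSpace X] [MeasurableSpace X] (eps : ℝ) (C : X → X → ℝ)
    (alpha beta : Measure X) : ℝ :=
  OTcost eps C alpha beta - (1/2) * OTcost eps C alpha alpha - (1/2) * OTcost eps C beta beta

/-- The squared kernel norm `‖ξ‖²_k = ∫∫ k dξ dξ` of the finite signed measure
`ξ = μ - ν`, written out in terms of its positive and negative parts. -/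
noncomputable def kerQuad {X : Type*} [MeasurableSpace X] (k : X → X → ℝ)
    (mu nu : Measure X) : ℝ :=
  ∫ x, ∫ y, k x y ∂mu ∂mu - ∫ x, ∫ y, k x y ∂nu ∂mu
    - ∫ x, ∫ y, k x y ∂mu ∂nu + ∫ x, ∫ y, k x y ∂nu ∂nu

/-- A kernel is positive definite if `‖ξ‖²_k ≥ 0` for every finite signed
Borel measure `ξ = μ - ν`. -/
def PosDef {X : Type*} [MeasurableSpace X] (k : X → X → ℝ) : Prop :=
  ∀ mu nu : Measure X, IsFiniteMeasure mu → IsFiniteMeasure nu →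
    0 ≤ kerQuad k mu nu

section BoundedMeasurable

variable {X : Type*} [MeasurableSpace X]

/-- Bounded measurable real functions. -/
def BddMeas (f : X → ℝ) : Prop := Measurable f ∧ ∃ M, ∀ x, |f x| ≤ M

lemma BddMeas.integrable {f : X → ℝ} (hf : BddMeas f) (mu : Measure X) [IsFiniteMeasure mu] :
    Integrable f mu := by
  obtain ⟨hm, M, hM⟩ := hf
  exact Integrable.of_bound hm.aestronglyMeasurable M (ae_of_all _ hM)

lemma BddMeas.add {f g : X → ℝ} (hf : BddMeas f) (hg : BddMeas g) :
    BddMeas (fun x => f x + g x) := by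
  obtain ⟨hfm, M, hM⟩ := hf
  obtain ⟨hgm, N, hN⟩ := hg
  exact ⟨hfm.add hgm, M + N, fun x => (abs_add_le _ _).trans (add_le_add (hM x) (hN x))⟩

lemma BddMeas.mul {f g : X → ℝ} (hf : BddMeas f) (hg : BddMeas g) :
    BddMeas (fun x => f x * g x) := by
  obtain ⟨hfm, M, hM⟩ := hf
  obtain ⟨hgm, N, hN⟩ := hg
  refine ⟨hfm.mul hgm, M * N, fun x => ?_⟩
  rw [abs_mul]
  exact mul_le_mul (hM x) (hN x) (abs_nonneg _) ((abs_nonneg _).trans (hM x))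

lemma BddMeas.const (c : ℝ) : BddMeas (fun _ : X => c) :=
  ⟨measurable_const, |c|, fun _ => le_rfl⟩

lemma BddMeas.sub {f g : X → ℝ} (hf : BddMeas f) (hg : BddMeas g) :
    BddMeas (fun x => f x - g x) := by
  simpa only [sub_eq_add_neg, neg_one_mul] using hf.add ((BddMeas.const (-1)).mul hg)

lemma BddMeas.exp {f : X → ℝ} (hf : BddMeas f) : BddMeas (fun x => Real.exp (f x)) := by
  obtain ⟨hfm, M, hM⟩ := hf
  refine ⟨hfm.exp, Real.exp M, fun x => ?_⟩
  rw [abs_of_pos (Real.exp_pos _)]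
  exact Real.exp_le_exp.2 ((le_abs_self _).trans (hM x))

lemma BddMeas.div_const {f : X → ℝ} (hf : BddMeas f) (c : ℝ) : BddMeas (fun x => f x / c) := by
  simpa only [div_eq_mul_inv] using hf.mul (BddMeas.const c⁻¹)

lemma BddMeas.comp {Y : Type*} [MeasurableSpace Y] {f : X → ℝ} (hf : BddMeas f) {e : Y → X}
    (he : Measurable e) : BddMeas (fun y => f (e y)) :=
  ⟨hf.1.comp he, hf.2.imp fun _ h y => h (e y)⟩

lemma Continuous.bddMeas [TopologicalSpace X] [CompactSpace X] [BorelSpace X] {f : X → ℝ}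
    (hf : Continuous f) : BddMeas f := by
  obtain ⟨M, hM⟩ := isCompact_univ.exists_bound_of_continuousOn hf.continuousOn
  exact ⟨hf.measurable, M, fun x => hM x (Set.mem_univ x)⟩

/-- A summand of a sum of two finite measures has a density with values in `[0, 1]`. -/
lemma exists_density_add (mu nu : Measure X) [IsFiniteMeasure mu] [IsFiniteMeasure nu] :
    ∃ p : X → ℝ, Measurable p ∧ (∀ x, 0 ≤ p x) ∧ (∀ x, p x ≤ 1) ∧
      ∀ phi : X → ℝ, ∫ x, p x * phi x ∂(mu + nu) = ∫ x, phi x ∂mu := by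
  have hle : mu ≤ mu + nu := Measure.le_add_right le_rfl
  refine ⟨fun x => min 1 (mu.rnDeriv (mu + nu) x).toReal,
    measurable_const.min (Measure.measurable_rnDeriv _ _).ennreal_toReal,
    fun x => le_min zero_le_one ENNReal.toReal_nonneg, fun x => min_le_left _ _, fun phi => ?_⟩
  rw [← integral_rnDeriv_smul hle.absolutelyContinuous]
  refine integral_congr_ae ?_
  filter_upwards [Measure.rnDeriv_le_one_of_le hle] with x hx
  have h1 : (mu.rnDeriv (mu + nu) x).toReal ≤ 1 := by
    simpa using ENNReal.toReal_mono ENNReal.one_ne_top hx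
  simp only [min_eq_right h1, smul_eq_mul]

/-- Positive definiteness of a kernel, tested on weighted measures. -/
lemma PosDef.weighted {k : X → X → ℝ} (hpd : PosDef k)
    (mu nu : Measure X) [IsFiniteMeasure mu] [IsFiniteMeasure nu] {u v : X → ℝ}
    (hu : BddMeas u) (hv : BddMeas v) (hu0 : ∀ x, 0 ≤ u x) (hv0 : ∀ x, 0 ≤ v x) :
    0 ≤ (∫ x, u x * ∫ y, k x y * u y ∂mu ∂mu) - (∫ x, u x * ∫ y, k x y * v y ∂nu ∂mu)
      - (∫ x, v x * ∫ y, k x y * u y ∂mu ∂nu) + ∫ x, v x * ∫ y, k x y * v y ∂nu ∂nu := by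
  have key : ∀ (m : Measure X) (w : X → ℝ), BddMeas w → (∀ x, 0 ≤ w x) → ∀ phi : X → ℝ,
      ∫ x, phi x ∂(m.withDensity fun x => ENNReal.ofReal (w x)) = ∫ x, w x * phi x ∂m := by
    intro m w hw hw0 phi
    rw [integral_withDensity_eq_integral_toReal_smul hw.1.ennreal_ofReal
      (ae_of_all _ fun x => ENNReal.ofReal_lt_top)]
    simp only [ENNReal.toReal_ofReal (hw0 _), smul_eq_mul]
  have hfm := isFiniteMeasure_withDensity_ofReal (hu.integrable mu).2
  have hfn := isFiniteMeasure_withDensity_ofReal (hv.integrable nu).2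
  have h := hpd _ _ hfm hfn
  simp only [kerQuad, key _ _ hu hu0, key _ _ hv hv0] at h
  simpa only [mul_comm (k _ _)] using h

lemma BddMeas.integral_mixture {mu nu : Measure X} [IsFiniteMeasure mu] [IsFiniteMeasure nu]
    {p : X → ℝ} (hp : BddMeas p)
    (hpi : ∀ phi : X → ℝ, ∫ x, p x * phi x ∂(mu + nu) = ∫ x, phi x ∂mu)
    {a b : X → ℝ} (ha : BddMeas a) (hb : BddMeas b) :
    ∫ x, (p x * a x + (1 - p x) * b x) ∂(mu + nu) = (∫ x, a x ∂mu) + ∫ x, b x ∂nu := by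
  have h1 : ∀ x, p x * a x + (1 - p x) * b x = (p x * a x - p x * b x) + b x :=
    fun x => by ring
  simp only [h1]
  rw [integral_add (((hp.mul ha).sub (hp.mul hb)).integrable _) (hb.integrable _),
    integral_sub ((hp.mul ha).integrable _) ((hp.mul hb).integrable _), hpi, hpi,
    integral_add_measure (hb.integrable _) (hb.integrable _)]
  ring

lemma isProbabilityMeasure_mixture (alpha0 alpha1 : Measure X) [IsProbabilityMeasure alpha0]
    [IsProbabilityMeasure alpha1] {t : ℝ} (ht0 : 0 ≤ t) (ht1 : t ≤ 1) :
    IsProbabilityMeasure (ENNReal.ofReal (1 - t) • alpha0 + ENNReal.ofReal t • alpha1) := by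
  constructor
  simp only [Measure.coe_add, Measure.coe_smul, Pi.add_apply, Pi.smul_apply, measure_univ,
    smul_eq_mul, mul_one]
  rw [← ENNReal.ofReal_add (sub_nonneg.2 ht1) ht0, sub_add_cancel, ENNReal.ofReal_one]

lemma integral_ofReal_smul (alpha : Measure X) {t : ℝ} (ht0 : 0 ≤ t) (phi : X → ℝ) :
    ∫ x, phi x ∂(ENNReal.ofReal t • alpha) = t * ∫ x, phi x ∂alpha := by
  rw [integral_smul_measure, ENNReal.toReal_ofReal ht0, smul_eq_mul]

lemma BddMeas.integral_convex_comb (alpha0 alpha1 : Measure X) [IsProbabilityMeasure alpha0]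
    [IsProbabilityMeasure alpha1] {t : ℝ} (ht0 : 0 ≤ t) (ht1 : t ≤ 1) {phi : X → ℝ}
    (hphi : BddMeas phi) :
    ∫ x, phi x ∂(ENNReal.ofReal (1 - t) • alpha0 + ENNReal.ofReal t • alpha1)
      = (1 - t) * (∫ x, phi x ∂alpha0) + t * ∫ x, phi x ∂alpha1 := by
  rw [integral_add_measure ((hphi.integrable _).smul_measure ENNReal.ofReal_ne_top)
    ((hphi.integrable _).smul_measure ENNReal.ofReal_ne_top),
    integral_ofReal_smul _ (sub_nonneg.2 ht1), integral_ofReal_smul _ ht0]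

end BoundedMeasurable

section Kernel

variable {X : Type*} [MetricSpace X] [CompactSpace X] [MeasurableSpace X] [BorelSpace X]

lemma continuous_kernel_integral {k : X → X → ℝ} (hk : Continuous (Function.uncurry k))
    (beta : Measure X) [IsFiniteMeasure beta] {v : X → ℝ} (hv : BddMeas v) :
    Continuous (fun x => ∫ y, k x y * v y ∂beta) := by
  obtain ⟨K, hK⟩ := isCompact_univ.exists_bound_of_continuousOn hk.continuousOn
  have hkx : ∀ x, Continuous (k x) := fun x => hk.comp (Continuous.prodMk_right x)
  refine continuous_of_dominated (bound := fun y => K * |v y|)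
    (fun x => ((hkx x).measurable.mul hv.1).aestronglyMeasurable)
    (fun x => ae_of_all _ fun y => ?_) ((hv.integrable beta).abs.const_mul K)
    (ae_of_all _ fun y => ?_)
  · rw [norm_mul]
    exact mul_le_mul_of_nonneg_right (hK (x, y) (Set.mem_univ _)) (abs_nonneg _)
  · exact (hk.comp (Continuous.prodMk_left y)).mul continuous_const

end Kernel

lemma continuous_gibbs {X : Type*} [TopologicalSpace X] {eps : ℝ} {C : X → X → ℝ}
    (hC : Continuous (Function.uncurry C)) :
    Continuous (Function.uncurry fun x y => Real.exp (-(C x y) / eps)) :=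
  Real.continuous_exp.comp (hC.neg.div_const eps)

lemma OTcost_le {X : Type*} [TopologicalSpace X] [MeasurableSpace X] {eps c : ℝ} {C : X → X → ℝ}
    {alpha beta : Measure X}
    (h : ∀ f g : X → ℝ, Continuous f → Continuous g → Dfun eps C alpha beta f g ≤ c) :
    OTcost eps C alpha beta ≤ c := by
  refine csSup_le ⟨_, 0, 0, continuous_zero, continuous_zero, rfl⟩ ?_
  rintro r ⟨f, g, hf, hg, rfl⟩
  exact h f g hf hg

section Dual

variable {X : Type*} [MetricSpace X] [CompactSpace X] [MeasurableSpace X] [BorelSpace X]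
  {eps : ℝ} {C : X → X → ℝ}

lemma Dfun_eq_integral_gibbs (hC : Continuous (Function.uncurry C)) (alpha beta : Measure X)
    [IsProbabilityMeasure alpha] [IsProbabilityMeasure beta] {f g : X → ℝ}
    (hf : BddMeas f) (hg : BddMeas g) :
    Dfun eps C alpha beta f g = (∫ x, f x ∂alpha) + (∫ y, g y ∂beta) + eps
      - eps * ∫ x, Real.exp (f x / eps) *
          ∫ y, Real.exp (-(C x y) / eps) * Real.exp (g y / eps) ∂beta ∂alpha := by
  have hk := continuous_gibbs (eps := eps) hC
  have hge := (hg.div_const eps).exp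
  have hZ := (continuous_kernel_integral hk beta hge).bddMeas
  have h1 : ∀ x, ∫ y, (Real.exp ((f x + g y - C x y) / eps) - 1) ∂beta
      = Real.exp (f x / eps) *
          (∫ y, Real.exp (-(C x y) / eps) * Real.exp (g y / eps) ∂beta) - 1 := by
    intro x
    have hkx : BddMeas fun y => Real.exp (-(C x y) / eps) :=
      (hk.comp (Continuous.prodMk_right x)).bddMeas
    have h2 : ∀ y, Real.exp ((f x + g y - C x y) / eps)
        = Real.exp (f x / eps) * (Real.exp (-(C x y) / eps) * Real.exp (g y / eps)) := by
      intro y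
      rw [← Real.exp_add, ← Real.exp_add]
      congr 1
      ring
    simp only [h2]
    rw [integral_sub (((hkx.mul hge).integrable beta).const_mul _) (integrable_const _),
      integral_const_mul]
    simp
  rw [Dfun]
  simp only [h1]
  rw [integral_sub (((hf.div_const eps).exp.mul hZ).integrable alpha) (integrable_const _)]
  simp only [integral_const, probReal_univ, smul_eq_mul, mul_one]
  ring

lemma bddMeas_prod_exp (hC : Continuous (Function.uncurry C)) {f g : X → ℝ}
    (hf : BddMeas f) (hg : BddMeas g) :
    BddMeas fun z : X × X => Real.exp ((f z.1 + g z.2 - C z.1 z.2) / eps) - 1 := by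
  have hCb : BddMeas fun z : X × X => C z.1 z.2 := hC.bddMeas
  exact ((((hf.comp measurable_fst).add (hg.comp measurable_snd)).sub hCb).div_const eps).exp.sub
    (BddMeas.const 1)

lemma Dfun_eq_integral_prod (hC : Continuous (Function.uncurry C)) (alpha beta : Measure X)
    [IsProbabilityMeasure alpha] [IsProbabilityMeasure beta] {f g : X → ℝ}
    (hf : BddMeas f) (hg : BddMeas g) :
    Dfun eps C alpha beta f g = ∫ z, (f z.1 + g z.2
      - eps * (Real.exp ((f z.1 + g z.2 - C z.1 z.2) / eps) - 1)) ∂(alpha.prod beta) := by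
  have hE := (bddMeas_prod_exp (eps := eps) hC hf hg).integrable (alpha.prod beta)
  have hf' := hf.comp (measurable_fst (β := X))
  have hg' := hg.comp (measurable_snd (α := X))
  rw [integral_sub ((hf'.add hg').integrable _) (hE.const_mul eps), integral_add (hf'.integrable _) (hg'.integrable _),
    integral_const_mul,
    integral_fun_fst, integral_fun_snd, integral_prod _ hE, Dfun]
  simp

lemma bddMeas_prod_dual (hC : Continuous (Function.uncurry C)) {f g : X → ℝ}
    (hf : BddMeas f) (hg : BddMeas g) :
    BddMeas fun z : X × X => f z.1 + g z.2
      - eps * (Real.exp ((f z.1 + g z.2 - C z.1 z.2) / eps) - 1) := by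
  exact ((hf.comp measurable_fst).add (hg.comp measurable_snd)).sub
    ((BddMeas.const eps).mul (bddMeas_prod_exp hC hf hg))

lemma Dfun_swap (hC : Continuous (Function.uncurry C)) (hCsym : ∀ x y, C x y = C y x)
    (alpha beta : Measure X) [IsProbabilityMeasure alpha] [IsProbabilityMeasure beta]
    {f g : X → ℝ} (hf : BddMeas f) (hg : BddMeas g) :
    Dfun eps C alpha beta f g = Dfun eps C beta alpha g f := by
  rw [Dfun_eq_integral_prod hC _ _ hf hg, Dfun_eq_integral_prod hC _ _ hg hf,
    ← integral_prod_swap]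
  refine integral_congr_ae (ae_of_all _ fun z => ?_)
  simp only [Prod.fst_swap, Prod.snd_swap]
  rw [hCsym z.2 z.1, add_comm (f z.2)]

lemma bddAbove_Dfun (heps : 0 < eps) (hC : Continuous (Function.uncurry C))
    (alpha beta : Measure X) [IsProbabilityMeasure alpha] [IsProbabilityMeasure beta] :
    BddAbove {r : ℝ | ∃ f g : X → ℝ, Continuous f ∧ Continuous g ∧
      r = Dfun eps C alpha beta f g} := by
  have hCb : BddMeas (Function.uncurry C) := hC.bddMeas
  refine ⟨∫ z, Function.uncurry C z ∂(alpha.prod beta), ?_⟩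
  rintro r ⟨f, g, hf, hg, rfl⟩
  rw [Dfun_eq_integral_prod hC _ _ hf.bddMeas hg.bddMeas]
  refine integral_mono ((bddMeas_prod_dual hC hf.bddMeas hg.bddMeas).integrable _)
    (hCb.integrable _) fun z => ?_
  have h := Real.add_one_le_exp ((f z.1 + g z.2 - C z.1 z.2) / eps)
  have h2 := mul_le_mul_of_nonneg_left h heps.le
  rw [mul_add, mul_div_cancel₀ _ heps.ne'] at h2
  simp only [Function.uncurry]
  linarith

lemma Dfun_le_OTcost (heps : 0 < eps) (hC : Continuous (Function.uncurry C))
    (alpha beta : Measure X) [IsProbabilityMeasure alpha] [IsProbabilityMeasure beta]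
    {f g : X → ℝ} (hf : Continuous f) (hg : Continuous g) :
    Dfun eps C alpha beta f g ≤ OTcost eps C alpha beta :=
  le_csSup (bddAbove_Dfun heps hC alpha beta) ⟨f, g, hf, hg, rfl⟩

/-- A Sinkhorn step: maximizing the dual functional over its first potential produces a continuous
potential. -/
lemma exists_continuous_Dfun_ge (heps : 0 < eps) (hC : Continuous (Function.uncurry C))
    (alpha beta : Measure X) [IsProbabilityMeasure alpha] [IsProbabilityMeasure beta]
    {f g : X → ℝ} (hf : BddMeas f) (hg : BddMeas g) :
    ∃ f' : X → ℝ, Continuous f' ∧ Dfun eps C alpha beta f g ≤ Dfun eps C alpha beta f' g := by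
  have hk := continuous_gibbs (eps := eps) hC
  have hge := (hg.div_const eps).exp
  set Z : X → ℝ := fun x => ∫ y, Real.exp (-(C x y) / eps) * Real.exp (g y / eps) ∂beta with hZdef
  have hZc : Continuous Z := continuous_kernel_integral hk beta hge
  have hZpos : ∀ x, 0 < Z x := by
    intro x
    have hkx : BddMeas fun y => Real.exp (-(C x y) / eps) :=
      (hk.comp (Continuous.prodMk_right x)).bddMeas
    simp only [hZdef, ← Real.exp_add]
    refine integral_exp_pos ?_
    simpa only [← Real.exp_add] using (hkx.mul hge).integrable beta
  have hf'c : Continuous fun x => -eps * Real.log (Z x) :=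
    continuous_const.mul (hZc.log fun x => (hZpos x).ne')
  refine ⟨_, hf'c, ?_⟩
  rw [Dfun_eq_integral_gibbs hC _ _ hf hg, Dfun_eq_integral_gibbs hC _ _ hf'c.bddMeas hg]
  change _ - eps * ∫ x, Real.exp (f x / eps) * Z x ∂alpha
    ≤ _ - eps * ∫ x, Real.exp (-eps * Real.log (Z x) / eps) * Z x ∂alpha
  have hone : ∀ x, Real.exp (-eps * Real.log (Z x) / eps) * Z x = 1 := by
    intro x
    rw [neg_mul, neg_div, mul_div_cancel_left₀ _ heps.ne', Real.exp_neg, Real.exp_log (hZpos x),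
      inv_mul_cancel₀ (hZpos x).ne']
  have hfi := hf.integrable alpha
  have hei := ((hf.div_const eps).exp.mul hZc.bddMeas).integrable alpha
  have hmain : ∫ x, (f x - eps * (Real.exp (f x / eps) * Z x)) ∂alpha
      ≤ ∫ x, (-eps * Real.log (Z x) - eps) ∂alpha := by
    refine integral_mono (hfi.sub (hei.const_mul eps))
      ((hf'c.bddMeas.integrable alpha).sub (integrable_const _)) fun x => ?_
    have h := Real.add_one_le_exp (f x / eps + Real.log (Z x))
    rw [Real.exp_add, Real.exp_log (hZpos x)] at h
    have h2 := mul_le_mul_of_nonneg_left h heps.le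
    rw [mul_add, mul_add, mul_div_cancel₀ _ heps.ne'] at h2
    simp only
    linarith
  rw [integral_sub hfi (hei.const_mul eps), integral_const_mul,
    integral_sub (hf'c.bddMeas.integrable alpha) (integrable_const _)] at hmain
  simp only [hone]
  simp only [integral_const, probReal_univ, smul_eq_mul, one_mul, mul_one] at hmain ⊢
  linarith

/-- Bounded measurable potentials do not increase the supremum defining the transport cost. -/
lemma BddMeas.Dfun_le_OTcost (heps : 0 < eps) (hC : Continuous (Function.uncurry C))
    (hCsym : ∀ x y, C x y = C y x)
    (alpha beta : Measure X) [IsProbabilityMeasure alpha] [IsProbabilityMeasure beta]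
    {f g : X → ℝ} (hf : BddMeas f) (hg : BddMeas g) :
    Dfun eps C alpha beta f g ≤ OTcost eps C alpha beta := by
  obtain ⟨f', hf', h1⟩ := exists_continuous_Dfun_ge heps hC alpha beta hf hg
  obtain ⟨g', hg', h2⟩ := exists_continuous_Dfun_ge heps hC beta alpha hg hf'.bddMeas
  rw [Dfun_swap hC hCsym _ _ hf'.bddMeas hg] at h1
  rw [Dfun_swap hC hCsym _ _ hg'.bddMeas hf'.bddMeas] at h2
  exact h1.trans (h2.trans (_root_.Dfun_le_OTcost heps hC _ _ hf' hg'))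

lemma Dfun_self_le_symm (heps : 0 < eps) (hC : Continuous (Function.uncurry C))
    (hCsym : ∀ x y, C x y = C y x) (alpha : Measure X) [IsProbabilityMeasure alpha]
    {f g : X → ℝ} (hf : BddMeas f) (hg : BddMeas g) :
    Dfun eps C alpha alpha f g
      ≤ Dfun eps C alpha alpha (fun x => (f x + g x) / 2) (fun x => (f x + g x) / 2) := by
  have hh : BddMeas fun x => (f x + g x) / 2 := (hf.add hg).div_const 2
  have hswap := Dfun_swap (eps := eps) hC hCsym alpha alpha hf hg
  suffices h : Dfun eps C alpha alpha f g + Dfun eps C alpha alpha g f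
      ≤ 2 * Dfun eps C alpha alpha (fun x => (f x + g x) / 2) (fun x => (f x + g x) / 2) by
    linarith
  rw [Dfun_eq_integral_prod hC _ _ hf hg, Dfun_eq_integral_prod hC _ _ hg hf,
    Dfun_eq_integral_prod hC _ _ hh hh, ← integral_const_mul,
    ← integral_add ((bddMeas_prod_dual hC hf hg).integrable _)
      ((bddMeas_prod_dual hC hg hf).integrable _)]
  refine integral_mono (((bddMeas_prod_dual hC hf hg).integrable _).add
      ((bddMeas_prod_dual hC hg hf).integrable _))
      (((bddMeas_prod_dual hC hh hh).integrable _).const_mul 2) fun z => ?_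
  simp only
  set a := (f z.1 + g z.2 - C z.1 z.2) / eps with ha
  set b := (g z.1 + f z.2 - C z.1 z.2) / eps with hb
  have hab : ((f z.1 + g z.1) / 2 + (f z.2 + g z.2) / 2 - C z.1 z.2) / eps = a / 2 + b / 2 := by
    rw [ha, hb]
    ring
  have ha2 : Real.exp a = Real.exp (a / 2) * Real.exp (a / 2) := by
    rw [← Real.exp_add, add_halves]
  have hb2 : Real.exp b = Real.exp (b / 2) * Real.exp (b / 2) := by
    rw [← Real.exp_add, add_halves]
  have hexp : 2 * Real.exp (a / 2 + b / 2) ≤ Real.exp a + Real.exp b := by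
    rw [Real.exp_add, ha2, hb2]
    nlinarith [sq_nonneg (Real.exp (a / 2) - Real.exp (b / 2))]
  rw [hab]
  nlinarith [mul_le_mul_of_nonneg_left hexp heps.le]

end Dual

section Mixture

variable {X : Type*} [MetricSpace X] [CompactSpace X] [MeasurableSpace X] [BorelSpace X]
  {eps : ℝ} {C : X → X → ℝ}

/-- The transport cost is convex in its first variable. -/
lemma OTcost_convex_left (heps : 0 < eps) (hC : Continuous (Function.uncurry C))
    (alpha0 alpha1 beta : Measure X) [IsProbabilityMeasure alpha0] [IsProbabilityMeasure alpha1]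
    [IsProbabilityMeasure beta] {t : ℝ} (ht0 : 0 ≤ t) (ht1 : t ≤ 1) :
    OTcost eps C (ENNReal.ofReal (1 - t) • alpha0 + ENNReal.ofReal t • alpha1) beta
      ≤ (1 - t) * OTcost eps C alpha0 beta + t * OTcost eps C alpha1 beta := by
  have := isProbabilityMeasure_mixture alpha0 alpha1 ht0 ht1
  refine OTcost_le fun f g hf hg => ?_
  have h0 := mul_le_mul_of_nonneg_left (Dfun_le_OTcost heps hC alpha0 beta hf hg)
    (sub_nonneg.2 ht1)
  have h1 := mul_le_mul_of_nonneg_left (Dfun_le_OTcost heps hC alpha1 beta hf hg) ht0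
  refine le_trans (le_of_eq ?_) (add_le_add h0 h1)
  have hfe := (hf.bddMeas.div_const eps).exp
  have hZ := (continuous_kernel_integral (continuous_gibbs (eps := eps) hC) beta
    (hg.bddMeas.div_const eps).exp).bddMeas
  simp only [Dfun_eq_integral_gibbs hC _ _ hf.bddMeas hg.bddMeas]
  rw [hf.bddMeas.integral_convex_comb _ _ ht0 ht1, (hfe.mul hZ).integral_convex_comb _ _ ht0 ht1]
  ring

/-- Concavity of the symmetric dual problem along mixtures, for a positive definite kernel. -/
lemma Dfun_self_mixture_le (heps : 0 < eps) (hC : Continuous (Function.uncurry C))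
    (hCsym : ∀ x y, C x y = C y x) (hpd : PosDef (fun x y => Real.exp (-(C x y) / eps)))
    (alpha0 alpha1 : Measure X) [IsProbabilityMeasure alpha0] [IsProbabilityMeasure alpha1]
    {t : ℝ} (ht0 : 0 ≤ t) (ht1 : t ≤ 1) {f0 f1 : X → ℝ} (hf0 : BddMeas f0) (hf1 : BddMeas f1) :
    (1 - t) * Dfun eps C alpha0 alpha0 f0 f0 + t * Dfun eps C alpha1 alpha1 f1 f1
      ≤ OTcost eps C (ENNReal.ofReal (1 - t) • alpha0 + ENNReal.ofReal t • alpha1)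
          (ENNReal.ofReal (1 - t) • alpha0 + ENNReal.ofReal t • alpha1) := by
  have hprob := isProbabilityMeasure_mixture alpha0 alpha1 ht0 ht1
  have hk := continuous_gibbs (eps := eps) hC
  have ht1' := sub_nonneg.2 ht1
  have : IsFiniteMeasure (ENNReal.ofReal (1 - t) • alpha0) :=
    alpha0.smul_finite ENNReal.ofReal_ne_top
  have : IsFiniteMeasure (ENNReal.ofReal t • alpha1) := alpha1.smul_finite ENNReal.ofReal_ne_top
  obtain ⟨p, hpm, hp0, hp1, hpi⟩ := exists_density_add (ENNReal.ofReal (1 - t) • alpha0)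
    (ENNReal.ofReal t • alpha1)
  have hp : BddMeas p := ⟨hpm, 1, fun x => abs_le.2 ⟨by linarith [hp0 x], hp1 x⟩⟩
  set alpha := ENNReal.ofReal (1 - t) • alpha0 + ENNReal.ofReal t • alpha1 with halpha
  have hmix : ∀ {a b : X → ℝ}, BddMeas a → BddMeas b →
      ∫ x, (p x * a x + (1 - p x) * b x) ∂alpha
        = (1 - t) * (∫ x, a x ∂alpha0) + t * ∫ x, b x ∂alpha1 := by
    intro a b ha hb
    rw [halpha, hp.integral_mixture hpi ha hb, integral_ofReal_smul _ ht1',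
      integral_ofReal_smul _ ht0]
  have hu0 := (hf0.div_const eps).exp
  have hu1 := (hf1.div_const eps).exp
  set u0 : X → ℝ := fun x => Real.exp (f0 x / eps) with hu0def
  set u1 : X → ℝ := fun x => Real.exp (f1 x / eps) with hu1def
  set u : X → ℝ := fun x => p x * u0 x + (1 - p x) * u1 x with hudef
  have hq : BddMeas fun x => 1 - p x := (BddMeas.const 1).sub hp
  have hu : BddMeas u := (hp.mul hu0).add (hq.mul hu1)
  obtain ⟨M, hM0, hM1⟩ : ∃ M, (∀ x, |f0 x / eps| ≤ M) ∧ ∀ x, |f1 x / eps| ≤ M := by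
    obtain ⟨M0, h0⟩ := (hf0.div_const eps).2
    obtain ⟨M1, h1⟩ := (hf1.div_const eps).2
    exact ⟨max M0 M1, fun x => (h0 x).trans (le_max_left _ _),
      fun x => (h1 x).trans (le_max_right _ _)⟩
  have hulow : ∀ x, Real.exp (-M) ≤ u x := by
    intro x
    have h0 : Real.exp (-M) ≤ u0 x := Real.exp_le_exp.2 (abs_le.1 (hM0 x)).1
    have h1 : Real.exp (-M) ≤ u1 x := Real.exp_le_exp.2 (abs_le.1 (hM1 x)).1
    simp only [hudef]
    nlinarith [mul_le_mul_of_nonneg_left h0 (hp0 x),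
      mul_le_mul_of_nonneg_left h1 (sub_nonneg.2 (hp1 x))]
  have huhigh : ∀ x, u x ≤ Real.exp M := by
    intro x
    have h0 : u0 x ≤ Real.exp M := Real.exp_le_exp.2 (abs_le.1 (hM0 x)).2
    have h1 : u1 x ≤ Real.exp M := Real.exp_le_exp.2 (abs_le.1 (hM1 x)).2
    simp only [hudef]
    nlinarith [mul_le_mul_of_nonneg_left h0 (hp0 x),
      mul_le_mul_of_nonneg_left h1 (sub_nonneg.2 (hp1 x))]
  have hupos : ∀ x, 0 < u x := fun x => (Real.exp_pos _).trans_le (hulow x)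
  have hlog : BddMeas fun x => Real.log (u x) := by
    refine ⟨hu.1.log, M, fun x => abs_le.2 ⟨?_, ?_⟩⟩
    · exact (Real.le_log_iff_exp_le (hupos x)).2 (hulow x)
    · exact (Real.log_le_iff_le_exp (hupos x)).2 (huhigh x)
  have hh : BddMeas fun x => eps * Real.log (u x) := (BddMeas.const eps).mul hlog
  have hexp : ∀ x, Real.exp (eps * Real.log (u x) / eps) = u x := by
    intro x
    rw [mul_div_cancel_left₀ _ heps.ne', Real.exp_log (hupos x)]
  refine le_trans ?_ (hh.Dfun_le_OTcost heps hC hCsym alpha alpha hh)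
  rw [Dfun_eq_integral_gibbs hC _ _ hh hh, Dfun_eq_integral_gibbs hC _ _ hf0 hf0,
    Dfun_eq_integral_gibbs hC _ _ hf1 hf1]
  simp only [hexp]
  have hlin : (1 - t) * (∫ x, f0 x ∂alpha0) + t * (∫ x, f1 x ∂alpha1)
      ≤ ∫ x, eps * Real.log (u x) ∂alpha := by
    rw [← hmix hf0 hf1]
    refine integral_mono (((hp.mul hf0).add (hq.mul hf1)).integrable _) (hh.integrable _)
      fun x => ?_
    have h := convexOn_exp.2 (Set.mem_univ (f0 x / eps)) (Set.mem_univ (f1 x / eps)) (hp0 x)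
      (sub_nonneg.2 (hp1 x)) (by ring)
    have h2 := mul_le_mul_of_nonneg_left ((Real.le_log_iff_exp_le (hupos x)).2 h) heps.le
    refine le_trans (le_of_eq ?_) h2
    simp only [smul_eq_mul]
    field_simp
  have hZ0 := (continuous_kernel_integral hk alpha0 hu0).bddMeas
  have hZ1 := (continuous_kernel_integral hk alpha1 hu1).bddMeas
  have hmulmix : ∀ {phi : X → ℝ}, BddMeas phi → ∫ x, phi x * u x ∂alpha
      = (1 - t) * (∫ x, phi x * u0 x ∂alpha0) + t * ∫ x, phi x * u1 x ∂alpha1 := by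
    intro phi hphi
    rw [← hmix (hphi.mul hu0) (hphi.mul hu1)]
    refine integral_congr_ae (ae_of_all _ fun x => ?_)
    simp only [hudef]
    ring
  have hinner : ∀ x, ∫ y, Real.exp (-(C x y) / eps) * u y ∂alpha
      = (1 - t) * (∫ y, Real.exp (-(C x y) / eps) * u0 y ∂alpha0)
        + t * ∫ y, Real.exp (-(C x y) / eps) * u1 y ∂alpha1 :=
    fun x => hmulmix (hk.comp (Continuous.prodMk_right x)).bddMeas
  have hquad : ∫ x, u x * ∫ y, Real.exp (-(C x y) / eps) * u y ∂alpha ∂alpha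
      ≤ (1 - t) * (∫ x, u0 x * ∫ y, Real.exp (-(C x y) / eps) * u0 y ∂alpha0 ∂alpha0)
        + t * ∫ x, u1 x * ∫ y, Real.exp (-(C x y) / eps) * u1 y ∂alpha1 ∂alpha1 := by
    have hP := hpd.weighted alpha0 alpha1 hu0 hu1 (fun x => (Real.exp_pos _).le)
      (fun x => (Real.exp_pos _).le)
    have hcomb : ∀ (m : Measure X) [IsProbabilityMeasure m] (w : X → ℝ), BddMeas w →
        ∫ x, ((1 - t) * (∫ y, Real.exp (-(C x y) / eps) * u0 y ∂alpha0)
          + t * ∫ y, Real.exp (-(C x y) / eps) * u1 y ∂alpha1) * w x ∂m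
        = (1 - t) * (∫ x, w x * ∫ y, Real.exp (-(C x y) / eps) * u0 y ∂alpha0 ∂m)
          + t * ∫ x, w x * ∫ y, Real.exp (-(C x y) / eps) * u1 y ∂alpha1 ∂m := by
      intro m _ w hw
      rw [← integral_const_mul, ← integral_const_mul,
        ← integral_add (((hw.mul hZ0).integrable m).const_mul _)
          (((hw.mul hZ1).integrable m).const_mul _)]
      refine integral_congr_ae (ae_of_all _ fun x => ?_)
      simp only
      ring
    have hstep : ∫ x, u x * ∫ y, Real.exp (-(C x y) / eps) * u y ∂alpha ∂alpha
        = ∫ x, ((1 - t) * (∫ y, Real.exp (-(C x y) / eps) * u0 y ∂alpha0)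
          + t * ∫ y, Real.exp (-(C x y) / eps) * u1 y ∂alpha1) * u x ∂alpha := by
      simp only [hinner, mul_comm (u _)]
    rw [hstep, hmulmix (((BddMeas.const _).mul hZ0).add ((BddMeas.const _).mul hZ1)),
      hcomb _ _ hu0, hcomb _ _ hu1]
    nlinarith [mul_nonneg (mul_nonneg ht0 ht1') hP]
  nlinarith [mul_le_mul_of_nonneg_left hquad heps.le]

/-- The self transport cost is concave when the Gibbs kernel is positive definite. -/
lemma OTcost_self_concave (heps : 0 < eps) (hC : Continuous (Function.uncurry C))
    (hCsym : ∀ x y, C x y = C y x) (hpd : PosDef (fun x y => Real.exp (-(C x y) / eps)))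
    (alpha0 alpha1 : Measure X) [IsProbabilityMeasure alpha0] [IsProbabilityMeasure alpha1]
    {t : ℝ} (ht0 : 0 ≤ t) (ht1 : t ≤ 1) :
    (1 - t) * OTcost eps C alpha0 alpha0 + t * OTcost eps C alpha1 alpha1
      ≤ OTcost eps C (ENNReal.ofReal (1 - t) • alpha0 + ENNReal.ofReal t • alpha1)
          (ENNReal.ofReal (1 - t) • alpha0 + ENNReal.ofReal t • alpha1) := by
  have happrox : ∀ (a : Measure X) [IsProbabilityMeasure a] (d : ℝ), 0 < d →
      ∃ f, BddMeas f ∧ OTcost eps C a a ≤ Dfun eps C a a f f + d := by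
    intro a _ d hd
    by_contra! hcon
    have h : OTcost eps C a a ≤ OTcost eps C a a - d := by
      refine OTcost_le fun f g hf hg => ?_
      have h1 := Dfun_self_le_symm heps hC hCsym a hf.bddMeas hg.bddMeas
      have h2 := hcon _ ((hf.bddMeas.add hg.bddMeas).div_const 2)
      linarith
    linarith
  refine le_of_forall_pos_le_add fun d hd => ?_
  obtain ⟨f0, hf0, h0⟩ := happrox alpha0 d hd
  obtain ⟨f1, hf1, h1⟩ := happrox alpha1 d hd
  have h := Dfun_self_mixture_le heps hC hCsym hpd alpha0 alpha1 ht0 ht1 hf0 hf1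
  have h0' := mul_le_mul_of_nonneg_left h0 (sub_nonneg.2 ht1)
  have h1' := mul_le_mul_of_nonneg_left h1 ht0
  linarith

end Mixture

/-- If the Gibbs kernel `k_ε` is positive definite, the Sinkhorn
divergence is convex in its first variable. -/
theorem sinkhorn_convex_left
    {X : Type*} [MetricSpace X] [CompactSpace X] [MeasurableSpace X] [BorelSpace X]
    (eps : ℝ) (heps : 0 < eps) (C : X → X → ℝ) (kappa : ℝ≥0) (hkappa : 0 < kappa)
    (hCsym : ∀ x y, C x y = C y x)
    (hClip1 : ∀ y, LipschitzWith kappa (fun x => C x y))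
    (hClip2 : ∀ x, LipschitzWith kappa (fun y => C x y))
    (hpd : PosDef (fun x y => Real.exp (-(C x y) / eps)))
    (beta : Measure X) [IsProbabilityMeasure beta]
    (alpha0 alpha1 : Measure X) [IsProbabilityMeasure alpha0] [IsProbabilityMeasure alpha1]
    (t : ℝ) (ht0 : 0 ≤ t) (ht1 : t ≤ 1) :
    Sinkhorn eps C (ENNReal.ofReal (1 - t) • alpha0 + ENNReal.ofReal t • alpha1) beta
      ≤ (1 - t) * Sinkhorn eps C alpha0 beta + t * Sinkhorn eps C alpha1 beta := by
  have hC : Continuous (Function.uncurry C) :=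
    continuous_prod_of_continuous_lipschitzWith _ kappa (fun x => (hClip2 x).continuous)
      (fun y => hClip1 y)
  have h1 := OTcost_convex_left heps hC alpha0 alpha1 beta ht0 ht1
  have h2 := OTcost_self_concave heps hC hCsym hpd alpha0 alpha1 ht0 ht1
  simp only [Sinkhorn]
  linarith
end

section
/- Let α_n ⇀ α and β_n ⇀ β be weakly converging sequences of Borel probability measures on X, fix an anchor point x₀ ∈ X, and suppose that for each n the pair of continuous functions (f_n, g_n) satisfies f_n = T_ε(β_n, g_n) and g_n = T_ε(α_n, f_n) on all of X with f_n(x₀) = 0. Then there exists a unique pair of continuous functions (f, g) satisfying f = T_ε(β, g) and g = T_ε(α, f) on all of X with f(x₀) = 0, and f_n → f and g_n → g uniformly on X. -/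
open MeasureTheory Real Filter Topology
open scoped NNReal ENNReal

/-- The Sinkhorn map `T_ε(α, f)(y) = -ε log ∫ exp((f(x) - C(x,y))/ε) dα(x)`. -/
noncomputable def Tmap {X : Type*} [MeasurableSpace X] (eps : ℝ) (C : X → X → ℝ)
    (alpha : Measure X) (f : X → ℝ) : X → ℝ :=
  fun y => -eps * Real.log (∫ x, Real.exp ((f x - C x y) / eps) ∂alpha)

section SinkhornMap

variable {X : Type*} [TopologicalSpace X] [CompactSpace X] [MeasurableSpace X] [BorelSpace X]

theorem Continuous.integrable_of_compactSpace {f : X → ℝ} (hf : Continuous f) (mu : Measure X)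
    [IsFiniteMeasure mu] : Integrable f mu :=
  hf.integrable_of_hasCompactSupport (HasCompactSupport.of_compactSpace f)

variable {eps : ℝ} {C : X → X → ℝ}

theorem integrable_exp_sub_div (hC : ∀ y, Continuous fun x => C x y) (mu : Measure X)
    [IsFiniteMeasure mu] {f : X → ℝ} (hf : Continuous f) (y : X) :
    Integrable (fun x => exp ((f x - C x y) / eps)) mu :=
  (continuous_exp.comp ((hf.sub (hC y)).div_const eps)).integrable_of_compactSpace mu

theorem exp_neg_Tmap_div (heps : 0 < eps) (hC : ∀ y, Continuous fun x => C x y)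
    (mu : Measure X) [IsProbabilityMeasure mu] {f : X → ℝ} (hf : Continuous f) (y : X) :
    exp (-Tmap eps C mu f y / eps) = ∫ x, exp ((f x - C x y) / eps) ∂mu := by
  have hpos := integral_exp_pos (integrable_exp_sub_div (eps := eps) hC mu hf y)
  have : -Tmap eps C mu f y / eps = log (∫ x, exp ((f x - C x y) / eps) ∂mu) := by
    unfold Tmap
    field_simp
  rw [this, exp_log hpos]

/-- Comparison principle for the Sinkhorn map. -/
theorem Tmap_le_Tmap_add (heps : 0 < eps) (hC : ∀ y, Continuous fun x => C x y)
    (mu : Measure X) [IsProbabilityMeasure mu] {f f' : X → ℝ} (hf : Continuous f)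
    (hf' : Continuous f') {y y' : X} {c : ℝ} (h : ∀ x, f' x - C x y' ≤ f x - C x y + c) :
    Tmap eps C mu f y ≤ Tmap eps C mu f' y' + c := by
  have h1 : exp (-Tmap eps C mu f' y' / eps) ≤ exp ((-Tmap eps C mu f y + c) / eps) := by
    rw [add_div, exp_add, exp_neg_Tmap_div heps hC mu hf', exp_neg_Tmap_div heps hC mu hf,
      ← integral_mul_const]
    refine integral_mono (integrable_exp_sub_div hC mu hf' y')
      ((integrable_exp_sub_div hC mu hf y).mul_const _) fun x => ?_
    simp only
    rw [← exp_add, ← add_div]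
    exact exp_le_exp.2 (div_le_div_of_nonneg_right (h x) heps.le)
  have h2 := (div_le_div_iff_of_pos_right heps).1 (exp_le_exp.1 h1)
  linarith

theorem abs_Tmap_le (heps : 0 < eps) (hC : ∀ y, Continuous fun x => C x y)
    (mu : Measure X) [IsProbabilityMeasure mu] {f : X → ℝ} (hf : Continuous f) {y : X} {R : ℝ}
    (h : ∀ x, |f x - C x y| ≤ R) : |Tmap eps C mu f y| ≤ R := by
  have key := exp_neg_Tmap_div heps hC mu hf y
  have hint := integrable_exp_sub_div (eps := eps) hC mu hf y
  have hup : exp (-Tmap eps C mu f y / eps) ≤ exp (R / eps) := by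
    rw [key]
    calc _ ≤ ∫ _, exp (R / eps) ∂mu := integral_mono hint (integrable_const _) fun x =>
          exp_le_exp.2 (div_le_div_of_nonneg_right (abs_le.1 (h x)).2 heps.le)
      _ = _ := by simp
  have hlo : exp (-R / eps) ≤ exp (-Tmap eps C mu f y / eps) := by
    rw [key]
    calc _ = ∫ _, exp (-R / eps) ∂mu := by simp
      _ ≤ _ := integral_mono (integrable_const _) hint fun x =>
          exp_le_exp.2 (div_le_div_of_nonneg_right (abs_le.1 (h x)).1 heps.le)
  have h1 := (div_le_div_iff_of_pos_right heps).1 (exp_le_exp.1 hup)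
  have h2 := (div_le_div_iff_of_pos_right heps).1 (exp_le_exp.1 hlo)
  exact abs_le.2 ⟨by linarith, by linarith⟩

/-- If `T_ε(μ, g') = T_ε(μ, g) - c` at one point, where `g + c ≤ g'`, then the same
identity holds at every point. -/
theorem Tmap_eq_sub_of_eq_sub_at (heps : 0 < eps) (hC : ∀ y, Continuous fun x => C x y)
    (mu : Measure X) [IsProbabilityMeasure mu] {g g' : X → ℝ} (hg : Continuous g)
    (hg' : Continuous g') {c : ℝ} (hle : ∀ x, g x + c ≤ g' x) {y : X}
    (hy : Tmap eps C mu g' y = Tmap eps C mu g y - c) (z : X) :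
    Tmap eps C mu g' z = Tmap eps C mu g z - c := by
  have hi := integrable_exp_sub_div (eps := eps) hC mu hg' y
  have hj := (integrable_exp_sub_div (eps := eps) hC mu hg y).mul_const (exp (c / eps))
  have hexp : ∀ w x, exp ((g x - C x w) / eps) * exp (c / eps) =
      exp ((g x + c - C x w) / eps) := fun w x => by
    rw [← exp_add]; congr 1; ring
  have hae : (fun x => exp ((g' x - C x y) / eps) - exp ((g x - C x y) / eps) * exp (c / eps))
      =ᵐ[mu] 0 := by
    refine (integral_eq_zero_iff_of_nonneg (fun x => ?_) (hi.sub hj)).1 ?_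
    · simp only [Pi.zero_apply, Pi.sub_apply, hexp, sub_nonneg]
      exact exp_le_exp.2 (div_le_div_of_nonneg_right (by linarith [hle x]) heps.le)
    · refine (integral_sub hi hj).trans ?_
      rw [integral_mul_const]
      rw [← exp_neg_Tmap_div heps hC mu hg', ← exp_neg_Tmap_div heps hC mu hg, hy, ← exp_add,
        sub_eq_zero]
      congr 1
      ring
  have hae' : ∀ᵐ x ∂mu, g' x = g x + c := by
    filter_upwards [hae] with x hx
    simp only [Pi.zero_apply, hexp, sub_eq_zero] at hx
    have := (div_left_inj' heps.ne').1 (exp_injective hx)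
    linarith
  have h1 : exp (-Tmap eps C mu g' z / eps) = exp ((-Tmap eps C mu g z + c) / eps) := by
    rw [add_div, exp_add, exp_neg_Tmap_div heps hC mu hg', exp_neg_Tmap_div heps hC mu hg,
      ← integral_mul_const]
    refine integral_congr_ae ?_
    filter_upwards [hae'] with x hx
    rw [hexp, hx]
  have := (div_left_inj' heps.ne').1 (exp_injective h1)
  linarith

/-- Solutions of the Sinkhorn system are unique once normalized at a point. -/
theorem Tmap_fixedPoint_unique (heps : 0 < eps) (hC : ∀ y, Continuous fun x => C x y)
    (alpha beta : Measure X) [IsProbabilityMeasure alpha] [IsProbabilityMeasure beta]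
    {f g f' g' : X → ℝ} (hf : Continuous f) (hg : Continuous g)
    (hf' : Continuous f') (hg' : Continuous g')
    (hfg : f = Tmap eps C beta g) (hgf : g = Tmap eps C alpha f)
    (hfg' : f' = Tmap eps C beta g') (hgf' : g' = Tmap eps C alpha f')
    {x0 : X} (h0 : f' x0 = f x0) : f' = f ∧ g' = g := by
  obtain ⟨y, -, hy⟩ := isCompact_univ.exists_isMinOn ⟨x0, Set.mem_univ _⟩
    (hg'.sub hg).continuousOn
  obtain ⟨x, -, hx⟩ := isCompact_univ.exists_isMaxOn ⟨x0, Set.mem_univ _⟩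
    (hf'.sub hf).continuousOn
  have hy' : ∀ z, g' y - g y ≤ g' z - g z := fun z => hy (Set.mem_univ z)
  have hx' : ∀ z, f' z - f z ≤ f' x - f x := fun z => hx (Set.mem_univ z)
  have h1 : f' x + (g' y - g y) ≤ f x := by
    have := Tmap_le_Tmap_add heps hC beta hg' hg (y := x) (y' := x) (c := -(g' y - g y))
      fun z => by linarith [hy' z]
    rw [← hfg, ← hfg'] at this
    linarith
  have h2 : g y ≤ g' y + (f' x - f x) := by
    have := Tmap_le_Tmap_add heps hC alpha hf hf' (y := y) (y' := y) (c := f' x - f x)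
      fun z => by linarith [hx' z]
    rwa [← hgf, ← hgf'] at this
  have h3 := Tmap_eq_sub_of_eq_sub_at heps hC beta hg hg' (c := g' y - g y)
    (fun z => by linarith [hy' z]) (y := x) (by rw [← hfg, ← hfg']; linarith)
  rw [← hfg, ← hfg'] at h3
  have hff : f' = f := funext fun z => by linarith [h3 z, h3 x0]
  exact ⟨hff, by rw [hgf', hgf, hff]⟩

/-- Joint convergence of integrals under weak convergence of measures and uniform convergence
of integrands. -/
theorem tendsto_integral_of_tendstoUniformly {ι : Type*} {l : Filter ι} {mus : ι → Measure X}
    {mu : Measure X} [∀ i, IsProbabilityMeasure (mus i)]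
    (hmu : ∀ f : X → ℝ, Continuous f →
      Tendsto (fun i => ∫ x, f x ∂(mus i)) l (𝓝 (∫ x, f x ∂mu)))
    {hs : ι → X → ℝ} {h : X → ℝ} (hsc : ∀ i, Continuous (hs i)) (hc : Continuous h)
    (hu : TendstoUniformly hs h l) :
    Tendsto (fun i => ∫ x, hs i x ∂(mus i)) l (𝓝 (∫ x, h x ∂mu)) := by
  have hdiff : Tendsto (fun i => ∫ x, (hs i x - h x) ∂(mus i)) l (𝓝 0) := by
    rw [Metric.tendsto_nhds]
    intro e he
    filter_upwards [Metric.tendstoUniformly_iff.1 hu (e / 2) (half_pos he)] with i hi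
    rw [dist_zero_right]
    have := norm_integral_le_of_norm_le_const (μ := mus i) (f := fun x => hs i x - h x)
      (C := e / 2) (ae_of_all _ fun x => by
        rw [← dist_eq_norm, dist_comm]; exact (hi x).le)
    simp only [probReal_univ, mul_one] at this
    linarith
  have := hdiff.add (hmu h hc)
  rw [zero_add] at this
  refine this.congr fun i => ?_
  rw [integral_sub ((hsc i).integrable_of_compactSpace _) (hc.integrable_of_compactSpace _),
    sub_add_cancel]

theorem tendsto_Tmap (hC : ∀ y, Continuous fun x => C x y) {ι : Type*} {l : Filter ι}
    {mus : ι → Measure X} {mu : Measure X} [∀ i, IsProbabilityMeasure (mus i)]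
    [IsProbabilityMeasure mu]
    (hmu : ∀ f : X → ℝ, Continuous f →
      Tendsto (fun i => ∫ x, f x ∂(mus i)) l (𝓝 (∫ x, f x ∂mu)))
    {fs : ι → X → ℝ} {f : X → ℝ} (hsc : ∀ i, Continuous (fs i)) (hc : Continuous f)
    (hu : TendstoUniformly fs f l) (y : X) :
    Tendsto (fun i => Tmap eps C (mus i) (fs i) y) l (𝓝 (Tmap eps C mu f y)) := by
  have hcont : Continuous fun x => (f x - C x y) / eps := (hc.sub (hC y)).div_const eps
  refine Tendsto.const_mul _ (Tendsto.log (tendsto_integral_of_tendstoUniformly hmu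
    (fun i => continuous_exp.comp (((hsc i).sub (hC y)).div_const eps))
    (continuous_exp.comp hcont) ?_) (integral_exp_pos (integrable_exp_sub_div hC mu hc y)).ne')
  let F : C(X, ℝ) := ⟨f, hc⟩
  let Fs : ι → C(X, ℝ) := fun i => ⟨fs i, hsc i⟩
  let c : C(X, ℝ) := ⟨fun x => C x y, hC y⟩
  let E : C(ℝ, ℝ) := ⟨fun t => exp (t / eps), by fun_prop⟩
  have h1 : Tendsto Fs l (𝓝 F) := ContinuousMap.tendsto_iff_tendstoUniformly.2 hu
  exact ContinuousMap.tendsto_iff_tendstoUniformly.1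
    (((ContinuousMap.continuous_postcomp E).tendsto _).comp (h1.sub_const c))

end SinkhornMap

theorem LipschitzWith.Tmap {X : Type*} [PseudoMetricSpace X] [CompactSpace X]
    [MeasurableSpace X] [BorelSpace X] {eps : ℝ} {C : X → X → ℝ} {kappa : ℝ≥0}
    (heps : 0 < eps) (hC : ∀ y, Continuous fun x => C x y)
    (hlip : ∀ x, LipschitzWith kappa fun y => C x y) (mu : Measure X) [IsProbabilityMeasure mu]
    {f : X → ℝ} (hf : Continuous f) : LipschitzWith kappa (Tmap eps C mu f) :=
  LipschitzWith.of_le_add_mul kappa fun y y' => Tmap_le_Tmap_add heps hC mu hf hf fun x => by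
    have h1 := (hlip x).dist_le_mul y y'
    rw [Real.dist_eq] at h1
    linarith [(abs_le.1 h1).2]

/-- Bounded sets of uniformly Lipschitz functions are relatively compact. -/
theorem isCompact_closure_lipschitz_bounded (X : Type*) [PseudoMetricSpace X] [CompactSpace X]
    (kappa : ℝ≥0) (R : ℝ) :
    IsCompact (closure {h : BoundedContinuousFunction X ℝ |
      LipschitzWith kappa h ∧ ∀ x, |h x| ≤ R}) := by
  refine BoundedContinuousFunction.arzela_ascoli (Metric.closedBall 0 R)
    (isCompact_closedBall 0 R) _ (fun h x hh => ?_) ?_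
  · rw [mem_closedBall_zero_iff]
    exact hh.2 x
  · exact (LipschitzWith.uniformEquicontinuous _ kappa fun h => h.2.1).equicontinuous

/-- The dual potentials (normalized at an anchor point `x₀`)
depend continuously on the input measures: for weakly converging `α_n ⇀ α`,
`β_n ⇀ β` with fixed points `(f_n, g_n)`, there is a unique normalized fixed
point `(f, g)` of the limit problem, and `f_n → f`, `g_n → g` uniformly. -/
theorem dual_potentials_weakly_continuous
    {X : Type*} [MetricSpace X] [CompactSpace X] [MeasurableSpace X] [BorelSpace X]
    (eps : ℝ) (heps : 0 < eps) (C : X → X → ℝ) (kappa : ℝ≥0) (hkappa : 0 < kappa)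
    (hCsym : ∀ x y, C x y = C y x)
    (hClip1 : ∀ y, LipschitzWith kappa (fun x => C x y))
    (hClip2 : ∀ x, LipschitzWith kappa (fun y => C x y))
    (alphaSeq betaSeq : ℕ → Measure X) (alpha beta : Measure X)
    [∀ n, IsProbabilityMeasure (alphaSeq n)] [∀ n, IsProbabilityMeasure (betaSeq n)]
    [IsProbabilityMeasure alpha] [IsProbabilityMeasure beta]
    (halpha : ∀ f : X → ℝ, Continuous f →
      Tendsto (fun n => ∫ x, f x ∂(alphaSeq n)) atTop (𝓝 (∫ x, f x ∂alpha)))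
    (hbeta : ∀ f : X → ℝ, Continuous f →
      Tendsto (fun n => ∫ x, f x ∂(betaSeq n)) atTop (𝓝 (∫ x, f x ∂beta)))
    (x0 : X) (fn gn : ℕ → X → ℝ)
    (hfnct : ∀ n, Continuous (fn n)) (hgnct : ∀ n, Continuous (gn n))
    (hfixf : ∀ n, fn n = Tmap eps C (betaSeq n) (gn n))
    (hfixg : ∀ n, gn n = Tmap eps C (alphaSeq n) (fn n))
    (hanchor : ∀ n, fn n x0 = 0) :
    ∃ f g : X → ℝ, Continuous f ∧ Continuous g ∧
      f = Tmap eps C beta g ∧ g = Tmap eps C alpha f ∧ f x0 = 0 ∧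
      (∀ f' g' : X → ℝ, Continuous f' → Continuous g' →
        f' = Tmap eps C beta g' → g' = Tmap eps C alpha f' → f' x0 = 0 →
        f' = f ∧ g' = g) ∧
      TendstoUniformly fn f atTop ∧ TendstoUniformly gn g atTop := by
  have hC1 : ∀ y, Continuous fun x => C x y := fun y => (hClip1 y).continuous
  set D : ℝ := Metric.diam (Set.univ : Set X)
  have hD : ∀ x y : X, dist x y ≤ D := fun x y =>
    Metric.dist_le_diam_of_mem isCompact_univ.isBounded (Set.mem_univ x) (Set.mem_univ y)
  have hCbd : ∀ x y, |C x y| ≤ |C x0 x0| + 2 * (kappa * D) := fun x y => by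
    have h1 := (hClip1 y).dist_le_mul x x0
    have h2 := (hClip2 x0).dist_le_mul y x0
    rw [Real.dist_eq] at h1 h2
    have h3 := mul_le_mul_of_nonneg_left (hD x x0) kappa.coe_nonneg
    have h4 := mul_le_mul_of_nonneg_left (hD y x0) kappa.coe_nonneg
    have h5 := abs_sub_abs_le_abs_sub (C x y) (C x0 y)
    have h6 := abs_sub_abs_le_abs_sub (C x0 y) (C x0 x0)
    linarith
  have hflip : ∀ n, LipschitzWith kappa (fn n) := fun n => by
    rw [hfixf n]
    exact LipschitzWith.Tmap heps hC1 hClip2 _ (hgnct n)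
  have hglip : ∀ n, LipschitzWith kappa (gn n) := fun n => by
    rw [hfixg n]
    exact LipschitzWith.Tmap heps hC1 hClip2 _ (hfnct n)
  have hfbd : ∀ n x, |fn n x| ≤ kappa * D := fun n x => by
    have h1 := (hflip n).dist_le_mul x x0
    rw [Real.dist_eq, hanchor n, sub_zero] at h1
    exact h1.trans (mul_le_mul_of_nonneg_left (hD x x0) kappa.coe_nonneg)
  have hgbd : ∀ n y, |gn n y| ≤ kappa * D + (|C x0 x0| + 2 * (kappa * D)) := fun n y => by
    rw [hfixg n]
    exact abs_Tmap_le heps hC1 _ (hfnct n) fun x =>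
      (abs_sub _ _).trans (add_le_add (hfbd n x) (hCbd x y))
  let u : ℕ → BoundedContinuousFunction X ℝ × BoundedContinuousFunction X ℝ := fun n =>
    (.mkOfCompact ⟨fn n, hfnct n⟩, .mkOfCompact ⟨gn n, hgnct n⟩)
  let S : ℝ → Set (BoundedContinuousFunction X ℝ) := fun R =>
    {h | LipschitzWith kappa h ∧ ∀ x, |h x| ≤ R}
  have hS : ∀ R, IsCompact (closure (S R)) := isCompact_closure_lipschitz_bounded X kappa
  have hK := (hS (kappa * D)).prod (hS (kappa * D + (|C x0 x0| + 2 * (kappa * D))))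
  have huK : ∀ n, u n ∈
      closure (S (kappa * D)) ×ˢ closure (S (kappa * D + (|C x0 x0| + 2 * (kappa * D)))) :=
    fun n => ⟨subset_closure ⟨hflip n, hfbd n⟩, subset_closure ⟨hglip n, hgbd n⟩⟩
  have hcluster : ∀ p, MapClusterPt p atTop u →
      (p.1 : X → ℝ) = Tmap eps C beta p.2 ∧ (p.2 : X → ℝ) = Tmap eps C alpha p.1 ∧
        p.1 x0 = 0 := by
    intro p hp
    obtain ⟨U, hU, hlim⟩ := mapClusterPt_iff_ultrafilter.1 hp
    have hf : TendstoUniformly fn p.1 U :=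
      BoundedContinuousFunction.tendsto_iff_tendstoUniformly.1 hlim.fst_nhds
    have hg : TendstoUniformly gn p.2 U :=
      BoundedContinuousFunction.tendsto_iff_tendstoUniformly.1 hlim.snd_nhds
    refine ⟨funext fun x => ?_, funext fun y => ?_, ?_⟩
    · refine tendsto_nhds_unique (hf.tendsto_at x) ?_
      simp only [hfixf]
      exact tendsto_Tmap hC1 (fun h hh => (hbeta h hh).mono_left hU) hgnct p.2.continuous hg x
    · refine tendsto_nhds_unique (hg.tendsto_at y) ?_
      simp only [hfixg]
      exact tendsto_Tmap hC1 (fun h hh => (halpha h hh).mono_left hU) hfnct p.1.continuous hf y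
    · refine tendsto_nhds_unique (hf.tendsto_at x0) ?_
      simp only [hanchor]
      exact tendsto_const_nhds
  obtain ⟨p, -, hp⟩ := hK.exists_mapClusterPt (f := atTop) (u := u)
    (tendsto_principal.2 (Eventually.of_forall huK))
  obtain ⟨hpf, hpg, hp0⟩ := hcluster p hp
  have huniq : ∀ f' g' : X → ℝ, Continuous f' → Continuous g' →
      f' = Tmap eps C beta g' → g' = Tmap eps C alpha f' → f' x0 = 0 →
      f' = p.1 ∧ g' = p.2 := fun f' g' hf' hg' hfg' hgf' h0 =>
    Tmap_fixedPoint_unique heps hC1 alpha beta p.1.continuous p.2.continuous hf' hg' hpf hpg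
      hfg' hgf' (h0.trans hp0.symm)
  have hlim : Tendsto u atTop (𝓝 p) :=
    hK.tendsto_nhds_of_unique_mapClusterPt (Eventually.of_forall huK) fun q _ hq => by
      obtain ⟨hqf, hqg, hq0⟩ := hcluster q hq
      obtain ⟨h1, h2⟩ := huniq q.1 q.2 q.1.continuous q.2.continuous hqf hqg hq0
      exact Prod.ext (DFunLike.coe_injective h1) (DFunLike.coe_injective h2)
  exact ⟨p.1, p.2, p.1.continuous, p.2.continuous, hpf, hpg, hp0, huniq,
    BoundedContinuousFunction.tendsto_iff_tendstoUniformly.1 hlim.fst_nhds,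
    BoundedContinuousFunction.tendsto_iff_tendstoUniformly.1 hlim.snd_nhds⟩
end
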